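/- Let 0 < α < 1, p ≥ 0, b ∈ ℝ, and let y be four times continuously differentiable on [b, X] with y(b) = y'(b) = y''(b) = 0 (y extended by zero to the left of b). Fix x with b < x < X. Then there exist constants C > 0 and h₀ > 0 such that for every integer n ≥ 1 and h = (x − b)/n with 0 < h < h₀ and x + p·h ≤ X, |h^(−α)·Δ_{h,p}^α y(x) − [(α/2 − p)·y^(α)(x − h) + (1 + p − α/2)·y^(α)(x)]| ≤ C·h². -/

import Mathlib

/-- The Caputo fractional derivative of order `α` with lower limit `b`. -/
noncomputable def caputo (α b : ℝ) (y : ℝ → ℝ) (x : ℝ) : ℝ :=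
  (1 / Real.Gamma (1 - α)) * ∫ ξ in b..x, deriv y ξ * (x - ξ) ^ (-α)

/-- The Grünwald weights `w_n^(α) = (-1)^n * C(α, n)`. -/
noncomputable def grunwaldW (α : ℝ) (n : ℕ) : ℝ :=
  (-1) ^ n * (Real.Gamma (α + 1) / (Real.Gamma ((n : ℝ) + 1) * Real.Gamma (α - (n : ℝ) + 1)))

/-- The shifted Grünwald difference operator with shift `p`, step `h`, lower limit `b`. -/
noncomputable def shiftedGrunwald (α b p h : ℝ) (y : ℝ → ℝ) (x : ℝ) : ℝ :=
  ∑ n ∈ Finset.range (⌊(x - b) / h⌋₊ + 1), grunwaldW α n * y (x - ((n : ℝ) - p) * h)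

/-- The partial sums of the Grünwald weights. -/
noncomputable def grunwaldPartialSum (α : ℝ) (j : ℕ) : ℝ :=
  ∑ k ∈ Finset.range (j + 1), grunwaldW α k

lemma grunwaldW_zero {α : ℝ} (hα : 0 < α) : grunwaldW α 0 = 1 := by
  have h : Real.Gamma (α + 1) ≠ 0 := (Real.Gamma_pos_of_pos (by linarith)).ne'
  simp [grunwaldW, h]

lemma grunwaldW_succ {α : ℝ} (hα0 : 0 < α) (hα1 : α < 1) (n : ℕ) :
    grunwaldW α (n + 1) = ((n : ℝ) - α) / (n + 1) * grunwaldW α n := by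
  have hne : α - (n : ℝ) ≠ 0 := by
    intro h
    have h1 : α = n := by linarith
    rw [h1] at hα0 hα1
    have h2 : 0 < n := by exact_mod_cast hα0
    have h3 : n < 1 := by exact_mod_cast hα1
    omega
  have hn : (n : ℝ) + 1 ≠ 0 := by positivity
  unfold grunwaldW
  have e1 : Real.Gamma (((n + 1 : ℕ) : ℝ) + 1) = (n + 1) * Real.Gamma ((n : ℝ) + 1) := by
    push_cast
    exact Real.Gamma_add_one hn
  have e2 : α - ((n + 1 : ℕ) : ℝ) + 1 = α - n := by push_cast; ring
  rw [e1, e2, Real.Gamma_add_one hne, pow_succ]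
  simp only [div_eq_mul_inv, mul_inv]
  field_simp
  ring

lemma grunwaldW_succ_eq_partialSum {α : ℝ} (hα0 : 0 < α) (hα1 : α < 1) (n : ℕ) :
    grunwaldW α (n + 1) = -(α / (n + 1)) * grunwaldPartialSum α n := by
  induction n with
  | zero =>
    rw [grunwaldW_succ hα0 hα1]
    simp [grunwaldPartialSum]
  | succ n ih =>
    rw [grunwaldW_succ hα0 hα1, grunwaldPartialSum, Finset.sum_range_succ, ← grunwaldPartialSum,
      ih]
    push_cast
    field_simp
    ring

lemma grunwaldPartialSum_zero {α : ℝ} (hα : 0 < α) : grunwaldPartialSum α 0 = 1 := by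
  simp [grunwaldPartialSum, grunwaldW_zero hα]

lemma grunwaldPartialSum_succ {α : ℝ} (hα0 : 0 < α) (hα1 : α < 1) (n : ℕ) :
    grunwaldPartialSum α (n + 1) = ((n : ℝ) + 1 - α) / (n + 1) * grunwaldPartialSum α n := by
  rw [grunwaldPartialSum, Finset.sum_range_succ, ← grunwaldPartialSum,
    grunwaldW_succ_eq_partialSum hα0 hα1]
  field_simp
  ring

lemma grunwaldPartialSum_pos {α : ℝ} (hα0 : 0 < α) (hα1 : α < 1) (n : ℕ) :
    0 < grunwaldPartialSum α n := by
  induction n with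
  | zero => simp [grunwaldPartialSum_zero hα0]
  | succ n ih =>
    rw [grunwaldPartialSum_succ hα0 hα1]
    have : 0 < (n : ℝ) + 1 - α := by have : (0 : ℝ) ≤ n := by positivity
                                     linarith
    positivity

lemma sum_abs_grunwaldW_le {α : ℝ} (hα0 : 0 < α) (hα1 : α < 1) (n : ℕ) :
    ∑ k ∈ Finset.range (n + 1), |grunwaldW α k| ≤ 2 := by
  have key : ∑ k ∈ Finset.range (n + 1), |grunwaldW α k| = 2 - grunwaldPartialSum α n := by
    induction n with
    | zero => simp [grunwaldPartialSum_zero hα0, grunwaldW_zero hα0]; norm_num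
    | succ n ih =>
      have h := grunwaldW_succ_eq_partialSum hα0 hα1 n
      have hp := grunwaldPartialSum_pos hα0 hα1 n
      have h0 : 0 ≤ α / ((n : ℝ) + 1) * grunwaldPartialSum α n := by positivity
      have hneg : grunwaldW α (n + 1) ≤ 0 := by rw [h]; linarith
      rw [Finset.sum_range_succ, ih, grunwaldPartialSum.eq_def α (n + 1), Finset.sum_range_succ,
        ← grunwaldPartialSum, abs_of_nonpos hneg]
      ring
  linarith [grunwaldPartialSum_pos hα0 hα1 n]

lemma sum_grunwaldW_mul_sub {α : ℝ} (hα0 : 0 < α) (hα1 : α < 1) (n : ℕ) :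
    ∑ k ∈ Finset.range (n + 1), grunwaldW α k * ((n : ℝ) - k) =
      n * grunwaldPartialSum α n / (1 - α) := by
  have ha : 1 - α ≠ 0 := by linarith
  induction n with
  | zero => simp
  | succ n ih =>
    have h : ∀ k ∈ Finset.range (n + 1), grunwaldW α k * (((n + 1 : ℕ) : ℝ) - k) =
        grunwaldW α k * ((n : ℝ) - k) + grunwaldW α k := by
      intro k _
      push_cast
      ring
    rw [Finset.sum_range_succ, Finset.sum_congr rfl h, Finset.sum_add_distrib, ih,
      ← grunwaldPartialSum, grunwaldPartialSum_succ hα0 hα1]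
    push_cast
    field_simp
    ring

lemma sum_grunwaldW_mul_sub_sq {α : ℝ} (hα0 : 0 < α) (hα1 : α < 1) (n : ℕ) :
    ∑ k ∈ Finset.range (n + 1), grunwaldW α k * ((n : ℝ) - k) ^ 2 =
      2 * (n * grunwaldPartialSum α n * (n - α / 2)) / ((1 - α) * (2 - α)) := by
  have ha : 1 - α ≠ 0 := by linarith
  have ha2 : 2 - α ≠ 0 := by linarith
  induction n with
  | zero => simp
  | succ n ih =>
    have h : ∀ k ∈ Finset.range (n + 1), grunwaldW α k * (((n + 1 : ℕ) : ℝ) - k) ^ 2 =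
        grunwaldW α k * ((n : ℝ) - k) ^ 2 + 2 * (grunwaldW α k * ((n : ℝ) - k))
          + grunwaldW α k := by
      intro k _
      push_cast
      ring
    rw [Finset.sum_range_succ, Finset.sum_congr rfl h, Finset.sum_add_distrib,
      Finset.sum_add_distrib, ih, ← Finset.mul_sum, sum_grunwaldW_mul_sub hα0 hα1,
      ← grunwaldPartialSum, grunwaldPartialSum_succ hα0 hα1]
    push_cast
    field_simp
    ring

/-- The normalised ratio `Γ(j + 1 - α) / Γ(j)`, written through the partial sums of the weights. -/
noncomputable def gammaRatio (α : ℝ) (j : ℕ) : ℝ :=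
  Real.Gamma (1 - α) * (j * grunwaldPartialSum α j)

lemma sum_grunwaldW_mul_add {α : ℝ} (hα0 : 0 < α) (hα1 : α < 1) {n : ℕ} (hn : 1 ≤ n) (q : ℝ) :
    ∑ k ∈ Finset.range (n + 1), grunwaldW α k * ((n : ℝ) - k + q) =
      gammaRatio α n * (1 + (1 - α) * q / n) / Real.Gamma (2 - α) := by
  have ha : 1 - α ≠ 0 := by linarith
  have hn' : (n : ℝ) ≠ 0 := by positivity
  have hG : Real.Gamma (1 - α) ≠ 0 := (Real.Gamma_pos_of_pos (by linarith)).ne'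
  have e : Real.Gamma (2 - α) = (1 - α) * Real.Gamma (1 - α) := by
    rw [← Real.Gamma_add_one ha]
    ring_nf
  simp only [mul_add, Finset.sum_add_distrib]
  rw [sum_grunwaldW_mul_sub hα0 hα1, ← Finset.sum_mul, ← grunwaldPartialSum, gammaRatio, e]
  field_simp

lemma sum_grunwaldW_mul_add_sq {α : ℝ} (hα0 : 0 < α) (hα1 : α < 1) {n : ℕ} (hn : 1 ≤ n) (q : ℝ) :
    ∑ k ∈ Finset.range (n + 1), grunwaldW α k * (((n : ℝ) - k + q) ^ 2 / 2) =
      gammaRatio α n * (n - α / 2 + (2 - α) * q + (2 - α) * (1 - α) * q ^ 2 / 2 / n) /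
        Real.Gamma (3 - α) := by
  have ha : 1 - α ≠ 0 := by linarith
  have ha2 : 2 - α ≠ 0 := by linarith
  have hn' : (n : ℝ) ≠ 0 := by positivity
  have hG : Real.Gamma (1 - α) ≠ 0 := (Real.Gamma_pos_of_pos (by linarith)).ne'
  have e : Real.Gamma (3 - α) = (2 - α) * ((1 - α) * Real.Gamma (1 - α)) := by
    rw [← Real.Gamma_add_one ha, show 1 - α + 1 = 2 - α by ring, ← Real.Gamma_add_one ha2]
    ring_nf
  have h : ∀ k ∈ Finset.range (n + 1), grunwaldW α k * (((n : ℝ) - k + q) ^ 2 / 2) =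
      (grunwaldW α k * ((n : ℝ) - k) ^ 2) * (1 / 2) + (grunwaldW α k * ((n : ℝ) - k)) * q
        + grunwaldW α k * (q ^ 2 / 2) := by
    intro k _
    ring
  rw [Finset.sum_congr rfl h, Finset.sum_add_distrib, Finset.sum_add_distrib, ← Finset.sum_mul,
    ← Finset.sum_mul, ← Finset.sum_mul, sum_grunwaldW_mul_sub hα0 hα1,
    sum_grunwaldW_mul_sub_sq hα0 hα1, ← grunwaldPartialSum, gammaRatio, e]
  field_simp

lemma two_mul_le_log_sub_log {t : ℝ} (ht0 : 0 ≤ t) (ht1 : t < 1) :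
    2 * t ≤ Real.log (1 + t) - Real.log (1 - t) := by
  have h := Real.hasSum_log_sub_log_of_abs_lt_one (x := t) (by rwa [abs_of_nonneg ht0])
  have := h.summable.le_tsum 0 (fun k _ => by positivity)
  rw [h.tsum_eq] at this
  simpa using this

lemma log_sub_log_le {t : ℝ} (ht0 : 0 ≤ t) (ht1 : t < 1) :
    Real.log (1 + t) - Real.log (1 - t) ≤ 2 * t / (1 - t ^ 2) := by
  have h := Real.hasSum_log_sub_log_of_abs_lt_one (x := t) (by rwa [abs_of_nonneg ht0])
  have h2 := (hasSum_geometric_of_lt_one (sq_nonneg t) (by nlinarith)).mul_left (2 * t)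
  rw [div_eq_mul_inv]
  refine hasSum_le (fun k => ?_) h h2
  have e : 2 * t * (t ^ 2) ^ k = 2 * 1 * t ^ (2 * k + 1) := by rw [← pow_mul]; ring
  rw [e]
  gcongr
  rw [div_le_one (by positivity)]
  linarith [show (0 : ℝ) ≤ k by positivity]

lemma log_sub_log_mul_le {a t : ℝ} (ha0 : 0 ≤ a) (ha1 : a ≤ 1) (ht0 : 0 ≤ t) (ht1 : t < 1) :
    Real.log (1 + a * t) - Real.log (1 - a * t) ≤
      a * (Real.log (1 + t) - Real.log (1 - t)) := by
  have hat : a * t < 1 := by nlinarith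
  have h := Real.hasSum_log_sub_log_of_abs_lt_one (x := a * t)
    (by rwa [abs_of_nonneg (by positivity)])
  have h2 := (Real.hasSum_log_sub_log_of_abs_lt_one (x := t)
    (by rwa [abs_of_nonneg ht0])).mul_left a
  refine hasSum_le (fun k => ?_) h h2
  have h3 : a ^ (2 * k + 1) ≤ a := by
    simpa using pow_le_pow_of_le_one ha0 ha1 (show 1 ≤ 2 * k + 1 by omega)
  calc 2 * (1 / (2 * (k : ℝ) + 1)) * (a * t) ^ (2 * k + 1)
      = a ^ (2 * k + 1) * (2 * (1 / (2 * (k : ℝ) + 1)) * t ^ (2 * k + 1)) := by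
        rw [mul_pow]; ring
    _ ≤ _ := by gcongr

/-- The logarithmic defect in `Γ(j + 1 - α) / Γ(j) ≈ (j - α / 2) ^ (1 - α)`. -/
noncomputable def gammaRatioDefect (α : ℝ) (j : ℕ) : ℝ :=
  Real.log (gammaRatio α j) - (1 - α) * Real.log (j - α / 2)

lemma gammaRatio_pos {α : ℝ} (hα0 : 0 < α) (hα1 : α < 1) {j : ℕ} (hj : 1 ≤ j) :
    0 < gammaRatio α j := by
  have := grunwaldPartialSum_pos hα0 hα1 j
  have hG : 0 < Real.Gamma (1 - α) := Real.Gamma_pos_of_pos (by linarith)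
  unfold gammaRatio
  positivity

lemma gammaRatio_succ {α : ℝ} (hα0 : 0 < α) (hα1 : α < 1) {j : ℕ} (hj : 1 ≤ j) :
    gammaRatio α (j + 1) = ((j : ℝ) + 1 - α) / j * gammaRatio α j := by
  have hj' : (j : ℝ) ≠ 0 := by positivity
  rw [gammaRatio, gammaRatio, grunwaldPartialSum_succ hα0 hα1]
  push_cast
  field_simp

lemma gammaRatioDefect_succ_sub {α : ℝ} (hα0 : 0 < α) (hα1 : α < 1) {j : ℕ} (hj : 1 ≤ j) :
    gammaRatioDefect α (j + 1) - gammaRatioDefect α j ≤ 0 ∧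
      -(1 / (j : ℝ) ^ 2 - 1 / ((j : ℝ) + 1) ^ 2) ≤
        gammaRatioDefect α (j + 1) - gammaRatioDefect α j := by
  have hj1 : (1 : ℝ) ≤ j := by exact_mod_cast hj
  have hj0 : (0 : ℝ) < j := by linarith
  set m : ℝ := j + (1 - α) / 2 with hm
  have hm1 : (j : ℝ) ≤ m := by rw [hm]; linarith
  have hm0 : 0 < m := by linarith
  set t : ℝ := 1 / (2 * m) with ht
  have ht0 : 0 ≤ t := by positivity
  have ht1 : t ≤ 1 / 2 := by
    rw [ht, div_le_div_iff₀ (by positivity) (by norm_num)]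
    linarith
  have htm : m * t = 1 / 2 := by rw [ht]; field_simp
  have hpos := gammaRatio_pos hα0 hα1 hj
  have hl1 : Real.log (((j : ℝ) + 1 - α) / j) =
      Real.log (1 + (1 - α) * t) - Real.log (1 - (1 - α) * t) := by
    have h1 : 0 < 1 + (1 - α) * t := by nlinarith
    have h2 : 0 < 1 - (1 - α) * t := by nlinarith
    rw [← Real.log_div h1.ne' h2.ne']
    congr 1
    rw [div_eq_div_iff hj0.ne' h2.ne']
    have : (j : ℝ) = m - (1 - α) / 2 := by rw [hm]; ring
    rw [this]
    linear_combination (- 2 * (1 - α)) * htm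
  have hl2 : Real.log ((j : ℝ) + 1 - α / 2) - Real.log (j - α / 2) =
      Real.log (1 + t) - Real.log (1 - t) := by
    have h1 : 0 < 1 + t := by linarith
    have h2 : 0 < 1 - t := by linarith
    have h3 : 0 < (j : ℝ) - α / 2 := by linarith
    have h4 : 0 < (j : ℝ) + 1 - α / 2 := by linarith
    rw [← Real.log_div h1.ne' h2.ne', ← Real.log_div h4.ne' h3.ne']
    congr 1
    rw [div_eq_div_iff h3.ne' h2.ne']
    have : (j : ℝ) = m - (1 - α) / 2 := by rw [hm]; ring
    rw [this]
    linear_combination (- 2) * htm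
  have key : gammaRatioDefect α (j + 1) - gammaRatioDefect α j =
      (Real.log (1 + (1 - α) * t) - Real.log (1 - (1 - α) * t)) -
        (1 - α) * (Real.log (1 + t) - Real.log (1 - t)) := by
    have h5 : 0 < ((j : ℝ) + 1 - α) / j := div_pos (by linarith) hj0
    rw [gammaRatioDefect, gammaRatioDefect, gammaRatio_succ hα0 hα1 hj,
      Real.log_mul h5.ne' hpos.ne', hl1, ← hl2]
    push_cast
    ring
  rw [key]
  constructor
  · have := log_sub_log_mul_le (a := 1 - α) (by linarith) (by linarith) ht0 (by linarith)
    linarith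
  · have h1 := two_mul_le_log_sub_log (t := (1 - α) * t) (by nlinarith) (by nlinarith)
    have h2 := log_sub_log_le ht0 (by linarith)
    have h3 : 2 * t / (1 - t ^ 2) - 2 * t ≤ 3 * t ^ 3 := by
      have : 0 < 1 - t ^ 2 := by nlinarith
      rw [tsub_le_iff_right, div_le_iff₀ this]
      have h6 : 0 ≤ t ^ 3 * (1 - 3 * t ^ 2) := by
        apply mul_nonneg (by positivity); nlinarith
      nlinarith
    have h4 : 3 * t ^ 3 ≤ 1 / (j : ℝ) ^ 2 - 1 / ((j : ℝ) + 1) ^ 2 := by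
      have h7 : t ≤ 1 / (2 * j) := by
        rw [ht]; gcongr
      calc 3 * t ^ 3 ≤ 3 * (1 / (2 * j)) ^ 3 := by gcongr
        _ ≤ _ := by
          rw [div_sub_div _ _ (by positivity) (by positivity), div_pow, ← mul_div_assoc,
            div_le_div_iff₀ (by positivity) (by positivity)]
          have : 0 ≤ (j : ℝ) ^ 2 * (13 * j ^ 2 + 2 * j - 3) :=
            mul_nonneg (by positivity) (by nlinarith)
          nlinarith
    have h8 : (1 - α) * (Real.log (1 + t) - Real.log (1 - t)) ≤
        (1 - α) * (2 * t + 3 * t ^ 3) :=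
      mul_le_mul_of_nonneg_left (by linarith) (by linarith)
    have h9 : 0 ≤ α * (3 * t ^ 3) := by positivity
    nlinarith

lemma prod_range_eq_grunwaldPartialSum {α : ℝ} (hα0 : 0 < α) (hα1 : α < 1) (n : ℕ) :
    ∏ j ∈ Finset.range n, (1 - α + (j : ℝ)) = n.factorial * grunwaldPartialSum α n := by
  induction n with
  | zero => simp [grunwaldPartialSum_zero hα0]
  | succ n ih =>
    rw [Finset.prod_range_succ, ih, grunwaldPartialSum_succ hα0 hα1, Nat.factorial_succ]
    push_cast
    field_simp
    ring

lemma tendsto_gammaRatioDefect {α : ℝ} (hα0 : 0 < α) (hα1 : α < 1) :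
    Filter.Tendsto (gammaRatioDefect α) Filter.atTop (nhds 0) := by
  have hG : 0 < Real.Gamma (1 - α) := Real.Gamma_pos_of_pos (by linarith)
  have h1 := Real.GammaSeq_tendsto_Gamma (1 - α)
  have h2 : Filter.Tendsto (fun n : ℕ => ((n : ℝ) + (1 - α)) / n) Filter.atTop (nhds 1) := by
    have : Filter.Tendsto (fun n : ℕ => 1 + (1 - α) / (n : ℝ)) Filter.atTop (nhds (1 + 0)) :=
      tendsto_const_nhds.add (tendsto_const_div_atTop_nhds_zero_nat _)
    rw [add_zero] at this
    refine this.congr' ?_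
    filter_upwards [Filter.eventually_ge_atTop 1] with n hn
    field_simp
  have h3 : Filter.Tendsto (fun n : ℕ => ((n : ℝ) - α / 2) / n) Filter.atTop (nhds 1) := by
    have : Filter.Tendsto (fun n : ℕ => 1 - (α / 2) / (n : ℝ)) Filter.atTop (nhds (1 - 0)) :=
      tendsto_const_nhds.sub (tendsto_const_div_atTop_nhds_zero_nat _)
    rw [sub_zero] at this
    refine this.congr' ?_
    filter_upwards [Filter.eventually_ge_atTop 1] with n hn
    field_simp
  have h4 := ((h1.log hG.ne').add (h2.log one_ne_zero)).add
    ((h3.log one_ne_zero).const_mul (1 - α))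
  have h5 := (tendsto_const_nhds (x := Real.log (Real.Gamma (1 - α)))).sub h4
  simp only [Real.log_one, mul_zero, add_zero, sub_self] at h5
  refine h5.congr' ?_
  filter_upwards [Filter.eventually_ge_atTop 1] with n hn
  have hn1 : (1 : ℝ) ≤ n := by exact_mod_cast hn
  have hn0 : (0 : ℝ) < n := by linarith
  have hA := grunwaldPartialSum_pos hα0 hα1 n
  have hf : (0 : ℝ) < n.factorial := by positivity
  have hz : 0 < (n : ℝ) - α / 2 := by linarith
  have hs : 0 < (n : ℝ) + (1 - α) := by linarith
  have hs' : 0 < 1 - α + (n : ℝ) := by linarith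
  rw [Real.GammaSeq, Finset.prod_range_succ, prod_range_eq_grunwaldPartialSum hα0 hα1,
    gammaRatioDefect, gammaRatio, Real.log_div (by positivity) (by positivity),
    Real.log_mul (by positivity) (by positivity), Real.log_mul (by positivity) (by positivity),
    Real.log_mul (by positivity) (by positivity), Real.log_mul (by positivity) (by positivity),
    Real.log_mul (by positivity) (by positivity), Real.log_div (by positivity) (by positivity),
    Real.log_div (by positivity) (by positivity), Real.log_rpow hn0,
    add_comm (1 - α) (n : ℝ)]
  ring

lemma gammaRatioDefect_bounds {α : ℝ} (hα0 : 0 < α) (hα1 : α < 1) {j : ℕ} (hj : 1 ≤ j) :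
    0 ≤ gammaRatioDefect α j ∧ gammaRatioDefect α j ≤ 1 / (j : ℝ) ^ 2 := by
  obtain ⟨k, rfl⟩ : ∃ k, j = k + 1 := ⟨j - 1, by omega⟩
  have hlim := (Filter.tendsto_add_atTop_iff_nat 1).2 (tendsto_gammaRatioDefect hα0 hα1)
  constructor
  · refine Antitone.le_of_tendsto (antitone_nat_of_succ_le fun n => ?_) hlim k
    linarith [(gammaRatioDefect_succ_sub hα0 hα1 (j := n + 1) (by omega)).1]
  · have hlim2 : Filter.Tendsto (fun n : ℕ => 1 / ((n : ℝ)) ^ 2) Filter.atTop (nhds 0) := by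
      have := (tendsto_const_div_atTop_nhds_zero_nat (1 : ℝ)).pow 2
      simpa using this
    have hlim3 := hlim.sub ((Filter.tendsto_add_atTop_iff_nat 1).2 hlim2)
    rw [sub_zero] at hlim3
    have := Monotone.ge_of_tendsto (monotone_nat_of_le_succ fun n => ?_) hlim3 k
    · linarith
    · have h := (gammaRatioDefect_succ_sub hα0 hα1 (j := n + 1) (by omega)).2
      push_cast at h ⊢
      linarith

lemma rpow_one_add_lower {β t : ℝ} (hβ0 : 0 ≤ β) (hβ1 : β ≤ 1) (ht : 0 ≤ t) :
    1 + β * t - t ^ 2 ≤ (1 + t) ^ β := by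
  have h1 := rpow_one_add_le_one_add_mul_self (s := t) (by linarith) (p := 1 - β)
    (by linarith) (by linarith)
  have h2 : (1 + t) ^ β * (1 + t) ^ (1 - β) = 1 + t := by
    rw [← Real.rpow_add (by linarith)]; simp
  have h3 : 0 ≤ (1 + t) ^ β := by positivity
  have h4 : 1 + t ≤ (1 + t) ^ β * (1 + (1 - β) * t) :=
    h2.symm.le.trans (mul_le_mul_of_nonneg_left h1 h3)
  have h5 : 0 < 1 + (1 - β) * t := by nlinarith
  by_contra! hc
  have h6 := mul_lt_mul_of_pos_right hc h5
  have h7 : 0 ≤ (1 - β) * t ^ 3 := by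
    have : 0 ≤ 1 - β := by linarith
    positivity
  have h8 : 0 ≤ (1 - β * (1 - β)) * t ^ 2 := mul_nonneg (by nlinarith) (sq_nonneg t)
  nlinarith

lemma abs_rpow_one_add_sub_le {β t : ℝ} (hβ0 : 0 ≤ β) (hβ2 : β ≤ 2) (ht : 0 ≤ t) :
    |(1 + t) ^ β - 1 - β * t| ≤ t ^ 2 := by
  rcases le_total β 1 with h | h
  · have h1 := rpow_one_add_le_one_add_mul_self (s := t) (by linarith) hβ0 h
    have h2 := rpow_one_add_lower hβ0 h ht
    rw [abs_le]
    constructor <;> nlinarith [sq_nonneg t]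
  · have h1 := rpow_one_add_le_one_add_mul_self (s := t) (by linarith) (p := β - 1)
      (by linarith) (by linarith)
    have h2 := one_add_mul_self_le_rpow_one_add (s := t) (by linarith) h
    have h3 : (1 + t) ^ β = (1 + t) * (1 + t) ^ (β - 1) := by
      rw [← Real.rpow_one_add' (by linarith) (by linarith)]; ring_nf
    have h4 : (1 + t) ^ β ≤ (1 + t) * (1 + (β - 1) * t) := by rw [h3]; gcongr
    rw [abs_le]
    constructor <;> nlinarith [sq_nonneg t]

lemma abs_add_rpow_sub_le {β m q : ℝ} (hβ0 : 0 ≤ β) (hβ2 : β ≤ 2) (hm : 0 < m) (hq : 0 ≤ q) :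
    |(m + q) ^ β - m ^ β - β * q * m ^ (β - 1)| ≤ q ^ 2 * m ^ (β - 2) := by
  have h := abs_rpow_one_add_sub_le hβ0 hβ2 (t := q / m) (by positivity)
  have e1 : (m + q) ^ β = m ^ β * (1 + q / m) ^ β := by
    rw [← Real.mul_rpow hm.le (by positivity)]
    congr 1
    field_simp
  have e2 : m ^ (β - 1) = m ^ β / m := Real.rpow_sub_one hm.ne' _
  have e3 : m ^ (β - 2) = m ^ β / m ^ 2 := by
    rw [show β - 2 = β - (2 : ℕ) by norm_num, Real.rpow_sub_natCast hm.ne']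
  rw [e1, e2, e3]
  have e4 : m ^ β * (1 + q / m) ^ β - m ^ β - β * q * (m ^ β / m) =
      m ^ β * ((1 + q / m) ^ β - 1 - β * (q / m)) := by field_simp
  rw [e4, abs_mul, abs_of_nonneg (by positivity)]
  calc m ^ β * |(1 + q / m) ^ β - 1 - β * (q / m)| ≤ m ^ β * (q / m) ^ 2 := by gcongr
    _ = _ := by field_simp

lemma abs_gammaRatio_sub_le {α : ℝ} (hα0 : 0 < α) (hα1 : α < 1) {j : ℕ} (hj : 1 ≤ j) :
    |gammaRatio α j - ((j : ℝ) - α / 2) ^ (1 - α)| ≤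
      2 * ((j : ℝ) - α / 2) ^ (1 - α) / (j : ℝ) ^ 2 := by
  have hj1 : (1 : ℝ) ≤ j := by exact_mod_cast hj
  have hz : 0 < (j : ℝ) - α / 2 := by linarith
  obtain ⟨h0, h1⟩ := gammaRatioDefect_bounds hα0 hα1 hj
  have h2 : 1 / (j : ℝ) ^ 2 ≤ 1 := by
    rw [div_le_one (by positivity)]; nlinarith
  have e : gammaRatio α j = ((j : ℝ) - α / 2) ^ (1 - α) * Real.exp (gammaRatioDefect α j) := by
    rw [Real.rpow_def_of_pos hz, ← Real.exp_add, gammaRatioDefect,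
      ← Real.exp_log (gammaRatio_pos hα0 hα1 hj)]
    congr 1
    rw [Real.log_exp]
    ring
  have h3 := Real.abs_exp_sub_one_le (x := gammaRatioDefect α j)
    (by rw [abs_of_nonneg h0]; linarith)
  rw [abs_of_nonneg h0] at h3
  have h4 : 0 ≤ ((j : ℝ) - α / 2) ^ (1 - α) := by positivity
  rw [e, show ((j : ℝ) - α / 2) ^ (1 - α) * Real.exp (gammaRatioDefect α j) -
    ((j : ℝ) - α / 2) ^ (1 - α) = ((j : ℝ) - α / 2) ^ (1 - α) *
      (Real.exp (gammaRatioDefect α j) - 1) by ring, abs_mul, abs_of_nonneg h4]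
  calc _ ≤ ((j : ℝ) - α / 2) ^ (1 - α) * (2 * (1 / (j : ℝ) ^ 2)) := by gcongr; linarith
    _ = _ := by ring

lemma rpow_eq_pow_mul_rpow {m : ℝ} (hm : 0 < m) (s : ℝ) (k : ℕ) :
    m ^ (s + k) = m ^ k * m ^ s := by
  rw [Real.rpow_add_natCast hm.ne', mul_comm]

lemma exists_gammaRatio_succ_eq {α : ℝ} (hα0 : 0 < α) (hα1 : α < 1) {m : ℕ} (hm : 1 ≤ m) :
    ∃ e : ℝ, |e| ≤ 5 ∧ gammaRatio α (m + 1) =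
      (m : ℝ) ^ (-1 - α) * ((m : ℝ) ^ 2 + (1 - α) * (1 - α / 2) * m + e) := by
  have hm1 : (1 : ℝ) ≤ m := by exact_mod_cast hm
  have hm0 : (0 : ℝ) < m := by linarith
  set X : ℝ := (m : ℝ) ^ (-1 - α) with hX
  have hX0 : 0 < X := by positivity
  have e1 : (m : ℝ) ^ (1 - α) = (m : ℝ) ^ 2 * X := by
    rw [hX, ← rpow_eq_pow_mul_rpow hm0]; congr 1; push_cast; ring
  have h1 := abs_gammaRatio_sub_le hα0 hα1 (j := m + 1) (by omega)
  have h2 := abs_add_rpow_sub_le (β := 1 - α) (m := m) (q := 1 - α / 2) (by linarith)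
    (by linarith) hm0 (by linarith)
  rw [show 1 - α - 1 = -1 - α + (1 : ℕ) by push_cast; ring, rpow_eq_pow_mul_rpow hm0,
    show 1 - α - 2 = -1 - α by ring, ← hX, e1] at h2
  push_cast at h1
  rw [show (m : ℝ) + 1 - α / 2 = m + (1 - α / 2) by ring] at h1
  have h3 : ((m : ℝ) + (1 - α / 2)) ^ (1 - α) ≤ 2 * ((m : ℝ) ^ 2 * X) := by
    calc ((m : ℝ) + (1 - α / 2)) ^ (1 - α) ≤ (2 * m : ℝ) ^ (1 - α) := by
          apply Real.rpow_le_rpow <;> linarith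
      _ = 2 ^ (1 - α) * ((m : ℝ) ^ 2 * X) := by rw [Real.mul_rpow (by norm_num) hm0.le, e1]
      _ ≤ 2 * ((m : ℝ) ^ 2 * X) := by
          gcongr
          simpa using Real.rpow_le_rpow_of_exponent_le (x := 2) (by norm_num)
            (show 1 - α ≤ 1 by linarith)
  have h4 : 2 * ((m : ℝ) + (1 - α / 2)) ^ (1 - α) / ((m : ℝ) + 1) ^ 2 ≤ 4 * X := by
    rw [div_le_iff₀ (by positivity)]
    nlinarith [mul_pos hX0 hm0]
  have h5 : (1 - α / 2) ^ 2 * X ≤ 1 * X := by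
    gcongr
    nlinarith
  refine ⟨(gammaRatio α (m + 1) - ((m : ℝ) ^ 2 * X + (1 - α) * (1 - α / 2) * (m * X))) / X, ?_, ?_⟩
  · rw [abs_div, abs_of_pos hX0, div_le_iff₀ hX0]
    rw [abs_le] at h1 h2 ⊢
    constructor <;> nlinarith
  · field_simp
    ring

/-- The kernel obtained from the right-hand side of the two-point formula applied to a truncated
quadratic. -/
noncomputable def twoPointKernel (α p r : ℝ) : ℝ :=
  ((α / 2 - p) * (max (r - 1) 0) ^ (2 - α) + (1 + p - α / 2) * r ^ (2 - α)) / Real.Gamma (3 - α)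

/-- The kernel obtained from the shifted Grünwald operator applied to a truncated quadratic. -/
noncomputable def grunwaldKernel (α p r : ℝ) : ℝ :=
  ∑ k ∈ Finset.range (⌊r⌋₊ + 1), grunwaldW α k * ((r - k + p) ^ 2 / 2)

lemma abs_linear_moment_sub_le {α p : ℝ} (hα0 : 0 < α) (hα1 : α < 1) (hp : 0 ≤ p) {n : ℕ}
    (hn : 2 ≤ n) :
    |(∑ k ∈ Finset.range (n + 1), grunwaldW α k * ((n : ℝ) - k + p)) -
      ((α / 2 - p) * ((n : ℝ) - 1) ^ (1 - α) + (1 + p - α / 2) * (n : ℝ) ^ (1 - α)) /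
        Real.Gamma (2 - α)| ≤ 4 * (8 * p + 6) / Real.Gamma (2 - α) * (n : ℝ) ^ (-1 - α) := by
  obtain ⟨m, rfl⟩ : ∃ m, n = m + 1 := ⟨n - 1, by omega⟩
  have hm : 1 ≤ m := by omega
  have hm1 : (1 : ℝ) ≤ m := by exact_mod_cast hm
  have hm0 : (0 : ℝ) < m := by linarith
  have hG : 0 < Real.Gamma (2 - α) := Real.Gamma_pos_of_pos (by linarith)
  obtain ⟨e, he, hρ⟩ := exists_gammaRatio_succ_eq hα0 hα1 hm
  set X : ℝ := (m : ℝ) ^ (-1 - α) with hX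
  have hX0 : 0 < X := by positivity
  have e1 : (m : ℝ) ^ (1 - α) = (m : ℝ) ^ 2 * X := by
    rw [hX, ← rpow_eq_pow_mul_rpow hm0]; congr 1; push_cast; ring
  have h2 := abs_add_rpow_sub_le (β := 1 - α) (m := m) (q := 1) (by linarith)
    (by linarith) hm0 (by linarith)
  rw [show 1 - α - 1 = -1 - α + (1 : ℕ) by push_cast; ring, rpow_eq_pow_mul_rpow hm0,
    show 1 - α - 2 = -1 - α by ring, ← hX, e1] at h2
  have hXn : X ≤ 4 * ((m : ℝ) + 1) ^ (-1 - α) := by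
    have h3 : (2 * m : ℝ) ^ (-1 - α) ≤ ((m : ℝ) + 1) ^ (-1 - α) :=
      Real.rpow_le_rpow_of_nonpos (by positivity) (by linarith) (by linarith)
    rw [Real.mul_rpow (by norm_num) hm0.le, ← hX] at h3
    have h4 : (2 : ℝ) ^ (-2 : ℝ) ≤ 2 ^ (-1 - α) :=
      Real.rpow_le_rpow_of_exponent_le (by norm_num) (by linarith)
    rw [Real.rpow_neg (by norm_num)] at h4
    norm_num at h4
    nlinarith
  rw [sum_grunwaldW_mul_add hα0 hα1 (by omega), hρ, ← sub_div, abs_div, abs_of_pos hG,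
    div_mul_eq_mul_div, div_le_div_iff_of_pos_right hG]
  push_cast
  rw [add_sub_cancel_right, e1]
  set g : ℝ := ((m : ℝ) + 1) ^ (1 - α) - (m : ℝ) ^ 2 * X - (1 - α) * 1 * ((m : ℝ) ^ 1 * X) with hg
  have hg' : ((m : ℝ) + 1) ^ (1 - α) = (m : ℝ) ^ 2 * X + (1 - α) * (m * X) + g := by
    rw [hg]; ring
  set v : ℝ := 1 / ((m : ℝ) + 1) with hv
  have hvm : (m + 1) * v = 1 := by rw [hv]; field_simp
  have hv0 : 0 ≤ v := by positivity
  have hv1 : v ≤ 1 := by rw [hv, div_le_one (by positivity)]; linarith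
  have hmv : m * v ≤ 1 := by linarith only [hvm, hv0]
  rw [hg', div_eq_mul_one_div _ ((m : ℝ) + 1), ← hv]
  have key : X * ((m : ℝ) ^ 2 + (1 - α) * (1 - α / 2) * m + e) * (1 + (1 - α) * p * v) -
      ((α / 2 - p) * ((m : ℝ) ^ 2 * X) + (1 + p - α / 2) *
        ((m : ℝ) ^ 2 * X + (1 - α) * (m * X) + g)) =
      X * (-((1 - α) * p * (m * v)) + (1 - α) * (1 - α / 2) * ((1 - α) * p) * (m * v)
        + e * (1 + (1 - α) * p * v)) - (1 + p - α / 2) * g := by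
    linear_combination (X * (1 - α) * p * m) * hvm
  rw [key]
  have b1 : |(1 - α) * p * (m * v)| ≤ p := by
    rw [abs_of_nonneg (by have : 0 ≤ 1 - α := by linarith
                          positivity)]
    calc (1 - α) * p * (m * v) ≤ 1 * p * 1 := by gcongr; linarith
      _ = p := by ring
  have b2 : |(1 - α) * (1 - α / 2) * ((1 - α) * p) * (m * v)| ≤ p := by
    have h1 : 0 ≤ 1 - α := by linarith
    have h2 : 0 ≤ 1 - α / 2 := by linarith
    rw [abs_of_nonneg (by positivity)]
    calc (1 - α) * (1 - α / 2) * ((1 - α) * p) * (m * v) ≤ 1 * 1 * (1 * p) * 1 := by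
          gcongr <;> linarith
      _ = p := by ring
  have b3 : |e * (1 + (1 - α) * p * v)| ≤ 5 * (1 + p) := by
    have h1 : 0 ≤ 1 - α := by linarith
    rw [abs_mul, abs_of_nonneg (a := 1 + (1 - α) * p * v) (by positivity)]
    calc |e| * (1 + (1 - α) * p * v) ≤ 5 * (1 + 1 * p * 1) := by gcongr; linarith
      _ = _ := by ring
  have b4 : |(1 + p - α / 2) * g| ≤ (1 + p) * X := by
    rw [abs_mul, abs_of_nonneg (a := 1 + p - α / 2) (by linarith)]
    rw [one_pow, one_mul] at h2
    gcongr
    linarith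
  calc _ ≤ X * (p + p + 5 * (1 + p)) + (1 + p) * X := by
        refine (abs_sub _ _).trans (add_le_add ?_ b4)
        rw [abs_mul, abs_of_pos hX0]
        gcongr
        refine (abs_add_le _ _).trans (add_le_add ((abs_add_le _ _).trans (add_le_add ?_ b2)) b3)
        rwa [abs_neg]
    _ = (8 * p + 6) * X := by ring
    _ ≤ (8 * p + 6) * (4 * ((m : ℝ) + 1) ^ (-1 - α)) := by gcongr
    _ = _ := by ring

lemma abs_kernel_sub_le_of_two_le {α p r : ℝ} (hα0 : 0 < α) (hα1 : α < 1) (hp : 0 ≤ p)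
    (hr : 2 ≤ r) :
    |grunwaldKernel α p r - twoPointKernel α p r| ≤
      3 * (40 * (p + 2) ^ 2) / Real.Gamma (3 - α) * r ^ (-α) := by
  have hr0 : 0 ≤ r := by linarith
  obtain ⟨m, hm'⟩ : ∃ m, ⌊r⌋₊ = m + 1 := by
    have : 2 ≤ ⌊r⌋₊ := Nat.le_floor (by exact_mod_cast hr)
    exact ⟨⌊r⌋₊ - 1, by omega⟩
  have hm : 1 ≤ m := by
    have : 2 ≤ ⌊r⌋₊ := Nat.le_floor (by exact_mod_cast hr)
    omega
  have hm1 : (1 : ℝ) ≤ m := by exact_mod_cast hm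
  have hm0 : (0 : ℝ) < m := by linarith
  have hG : 0 < Real.Gamma (3 - α) := Real.Gamma_pos_of_pos (by linarith)
  set θ : ℝ := r - (m + 1) with hθ
  have hθ0 : 0 ≤ θ := by
    have := Nat.floor_le hr0
    rw [hm'] at this
    push_cast at this
    linarith
  have hθ1 : θ ≤ 1 := by
    have := (Nat.lt_floor_add_one r).le
    rw [hm'] at this
    push_cast at this
    linarith
  have hrθ : r = m + (1 + θ) := by rw [hθ]; ring
  obtain ⟨e, he, hρ⟩ := exists_gammaRatio_succ_eq hα0 hα1 hm
  set X : ℝ := (m : ℝ) ^ (-1 - α) with hX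
  have hX0 : 0 < X := by positivity
  have e0 : (m : ℝ) ^ (-α) = m * X := by
    have := rpow_eq_pow_mul_rpow hm0 (-1 - α) 1
    rw [pow_one, ← hX] at this
    rw [← this]; congr 1; push_cast; ring
  have e1 : (m : ℝ) ^ (1 - α) = (m : ℝ) ^ 2 * X := by
    rw [hX, ← rpow_eq_pow_mul_rpow hm0]; congr 1; push_cast; ring
  have e2 : (m : ℝ) ^ (2 - α) = (m : ℝ) ^ 3 * X := by
    rw [hX, ← rpow_eq_pow_mul_rpow hm0]; congr 1; push_cast; ring
  have t1 := abs_add_rpow_sub_le (β := 2 - α) (m := m) (q := θ) (by linarith)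
    (by linarith) hm0 hθ0
  have t2 := abs_add_rpow_sub_le (β := 2 - α) (m := m) (q := 1 + θ) (by linarith)
    (by linarith) hm0 (by linarith)
  rw [show 2 - α - 1 = 1 - α by ring, show 2 - α - 2 = -α by ring, e0, e1, e2] at t1 t2
  set g1 : ℝ := (m + θ) ^ (2 - α) - (m : ℝ) ^ 3 * X - (2 - α) * θ * ((m : ℝ) ^ 2 * X) with hg1
  set g2 : ℝ := (m + (1 + θ)) ^ (2 - α) - (m : ℝ) ^ 3 * X -
    (2 - α) * (1 + θ) * ((m : ℝ) ^ 2 * X) with hg2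
  have hg1' : (m + θ) ^ (2 - α) = (m : ℝ) ^ 3 * X + (2 - α) * θ * ((m : ℝ) ^ 2 * X) + g1 := by
    rw [hg1]; ring
  have hg2' : (m + (1 + θ)) ^ (2 - α) = (m : ℝ) ^ 3 * X +
      (2 - α) * (1 + θ) * ((m : ℝ) ^ 2 * X) + g2 := by
    rw [hg2]; ring
  have hXr : m * X ≤ 3 * r ^ (-α) := by
    have h3 : (3 * m : ℝ) ^ (-α) ≤ r ^ (-α) :=
      Real.rpow_le_rpow_of_nonpos (by linarith) (by linarith) (by linarith)
    rw [Real.mul_rpow (by norm_num) hm0.le, e0] at h3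
    have h4 : (3 : ℝ) ^ (-1 : ℝ) ≤ 3 ^ (-α) :=
      Real.rpow_le_rpow_of_exponent_le (by norm_num) (by linarith)
    rw [Real.rpow_neg_one] at h4
    have := mul_le_mul_of_nonneg_right h4 (mul_nonneg hm0.le hX0.le)
    linarith
  have hsum : grunwaldKernel α p r = gammaRatio α (m + 1) * ((m + 1 : ℕ) - α / 2 +
      (2 - α) * (θ + p) + (2 - α) * (1 - α) * (θ + p) ^ 2 / 2 / ((m + 1 : ℕ) : ℝ)) /
        Real.Gamma (3 - α) := by
    rw [← sum_grunwaldW_mul_add_sq hα0 hα1 (by omega), grunwaldKernel, hm']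
    refine Finset.sum_congr rfl fun k _ => ?_
    rw [hrθ]
    push_cast
    ring
  have hmax : max (r - 1) 0 = m + θ := by
    rw [max_eq_left (by linarith), hrθ]; ring
  rw [hsum, twoPointKernel, hmax, hrθ, hρ, hg1', hg2', ← hrθ, ← sub_div, abs_div, abs_of_pos hG,
    div_mul_eq_mul_div, div_le_div_iff_of_pos_right hG]
  push_cast
  set v : ℝ := 1 / ((m : ℝ) + 1) with hv
  have hv0 : 0 ≤ v := by positivity
  have hvm : (m + 1) * v = 1 := by rw [hv]; field_simp
  have hmv : m * v ≤ 1 := by linarith only [hvm, hv0]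
  set q : ℝ := θ + p with hq
  have hq0 : 0 ≤ q := by linarith
  have hqp : q ≤ p + 1 := by linarith
  rw [div_eq_mul_one_div _ ((m : ℝ) + 1), ← hv]
  set f : ℝ := (2 - α) * (1 - α) * q ^ 2 / 2 * v with hf
  set c : ℝ := 1 - α / 2 + (2 - α) * q with hc
  have ha : 0 ≤ 1 - α := by linarith
  have ha2 : 0 ≤ 2 - α := by linarith
  have ha3 : 0 ≤ 1 - α / 2 := by linarith
  have hf0 : 0 ≤ f := by rw [hf]; positivity
  have hmf : m * f ≤ (p + 1) ^ 2 := by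
    calc m * f = (1 - α / 2) * (1 - α) * q ^ 2 * (m * v) := by rw [hf]; ring
      _ ≤ 1 * 1 * (p + 1) ^ 2 * 1 := by gcongr <;> linarith
      _ = _ := by ring
  have hfle : f ≤ (p + 1) ^ 2 := (le_mul_of_one_le_left hf0 hm1).trans hmf
  have hc0 : 0 ≤ c := by rw [hc]; positivity
  have hc1 : c ≤ 2 * p + 3 := by
    calc c ≤ 1 + 2 * (p + 1) := by rw [hc]; gcongr <;> linarith
      _ = _ := by ring
  have key : X * ((m : ℝ) ^ 2 + (1 - α) * (1 - α / 2) * m + e) *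
      ((m : ℝ) + 1 - α / 2 + (2 - α) * q + f) -
      ((α / 2 - p) * ((m : ℝ) ^ 3 * X + (2 - α) * θ * ((m : ℝ) ^ 2 * X) + g1) +
        (1 + p - α / 2) * ((m : ℝ) ^ 3 * X + (2 - α) * (1 + θ) * ((m : ℝ) ^ 2 * X) + g2)) =
      X * (m * (m * f) + (1 - α) * (1 - α / 2) * m * (c + f) + e * (m + c + f)) -
        (α / 2 - p) * g1 - (1 + p - α / 2) * g2 := by
    rw [hc, hq]
    ring
  rw [key]
  have b1 : |m * (m * f)| ≤ m * (p + 1) ^ 2 := by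
    rw [abs_of_nonneg (by positivity)]
    gcongr
  have b2 : |(1 - α) * (1 - α / 2) * m * (c + f)| ≤ m * (2 * p + 3 + (p + 1) ^ 2) := by
    rw [abs_of_nonneg (by positivity)]
    calc (1 - α) * (1 - α / 2) * m * (c + f) ≤ 1 * 1 * m * (2 * p + 3 + (p + 1) ^ 2) := by
          gcongr <;> linarith
      _ = _ := by ring
  have b3 : |e * (m + c + f)| ≤ 5 * (m * (1 + (2 * p + 3) + (p + 1) ^ 2)) := by
    rw [abs_mul, abs_of_nonneg (a := m + c + f) (by positivity)]
    have h1 : 2 * p + 3 ≤ m * (2 * p + 3) := le_mul_of_one_le_left (by positivity) hm1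
    have h2 : (p + 1) ^ 2 ≤ m * (p + 1) ^ 2 := le_mul_of_one_le_left (by positivity) hm1
    gcongr
    linarith
  have b4 : |(α / 2 - p) * g1| ≤ (1 + p) * (m * X) := by
    rw [abs_mul]
    have h1 : |α / 2 - p| ≤ 1 + p := by rw [abs_le]; constructor <;> linarith
    have h2 : |g1| ≤ m * X := t1.trans (mul_le_of_le_one_left (by positivity) (pow_le_one₀ hθ0 hθ1))
    gcongr
  have b5 : |(1 + p - α / 2) * g2| ≤ (1 + p) * (4 * (m * X)) := by
    rw [abs_mul, abs_of_nonneg (a := 1 + p - α / 2) (by linarith)]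
    have h3 : (1 + θ) ^ 2 ≤ 4 := by
      calc (1 + θ) ^ 2 ≤ (1 + 1) ^ 2 := by gcongr
        _ = 4 := by norm_num
    have h2 : |g2| ≤ 4 * (m * X) := t2.trans (by gcongr)
    gcongr
    linarith
  calc _ ≤ X * (m * (p + 1) ^ 2 + m * (2 * p + 3 + (p + 1) ^ 2) +
        5 * (m * (1 + (2 * p + 3) + (p + 1) ^ 2))) + (1 + p) * (m * X) +
          (1 + p) * (4 * (m * X)) := by
        refine (abs_sub _ _).trans (add_le_add ((abs_sub _ _).trans (add_le_add ?_ b4)) b5)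
        rw [abs_mul, abs_of_pos hX0]
        gcongr
        exact (abs_add_le _ _).trans (add_le_add ((abs_add_le _ _).trans (add_le_add b1 b2)) b3)
    _ = (7 * (p + 1) ^ 2 + 17 * p + 28) * (m * X) := by ring
    _ ≤ 40 * (p + 2) ^ 2 * (m * X) := by
        gcongr
        linarith only [sq_nonneg p, hp, show 40 * (p + 2) ^ 2 - (7 * (p + 1) ^ 2 + 17 * p + 28) =
          33 * p ^ 2 + 129 * p + 125 by ring]
    _ ≤ 40 * (p + 2) ^ 2 * (3 * r ^ (-α)) := by gcongr
    _ = _ := by ring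

lemma abs_kernel_sub_le_of_lt_two {α p r : ℝ} (hα0 : 0 < α) (hα1 : α < 1) (hp : 0 ≤ p)
    (hr0 : 0 < r) (hr : r < 2) :
    |grunwaldKernel α p r - twoPointKernel α p r| ≤
      2 * ((p + 2) ^ 2 + 5 * (1 + p) / Real.Gamma (3 - α)) * r ^ (-α) := by
  have hG : 0 < Real.Gamma (3 - α) := Real.Gamma_pos_of_pos (by linarith)
  have h1 : 1 ≤ 2 * r ^ (-α) := by
    have h3 : (2 : ℝ) ^ (-α) ≤ r ^ (-α) :=
      Real.rpow_le_rpow_of_nonpos hr0 hr.le (by linarith)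
    have h4 : (2 : ℝ) ^ (-1 : ℝ) ≤ 2 ^ (-α) :=
      Real.rpow_le_rpow_of_exponent_le (by norm_num) (by linarith)
    rw [Real.rpow_neg_one] at h4
    linarith
  have h2 : |grunwaldKernel α p r| ≤ (p + 2) ^ 2 := by
    calc |grunwaldKernel α p r|
        ≤ ∑ k ∈ Finset.range (⌊r⌋₊ + 1), |grunwaldW α k * ((r - k + p) ^ 2 / 2)| :=
          Finset.abs_sum_le_sum_abs _ _
      _ ≤ ∑ k ∈ Finset.range (⌊r⌋₊ + 1), |grunwaldW α k| * ((p + 2) ^ 2 / 2) := by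
          refine Finset.sum_le_sum fun k hk => ?_
          have hk1 : k ≤ ⌊r⌋₊ := by simpa [Nat.lt_succ_iff] using hk
          have hk2 : (k : ℝ) ≤ r := (Nat.cast_le.2 hk1).trans (Nat.floor_le hr0.le)
          have hk3 : (0 : ℝ) ≤ k := by positivity
          rw [abs_mul, abs_of_nonneg (a := (r - k + p) ^ 2 / 2) (by positivity)]
          gcongr ?_ * (?_ ^ 2 / 2)
          linarith
      _ ≤ 2 * ((p + 2) ^ 2 / 2) := by
          rw [← Finset.sum_mul]
          gcongr
          exact sum_abs_grunwaldW_le hα0 hα1 _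
      _ = _ := by ring
  have h3 : |twoPointKernel α p r| ≤ 5 * (1 + p) / Real.Gamma (3 - α) := by
    rw [twoPointKernel, abs_div, abs_of_pos hG]
    gcongr
    have a1 : (max (r - 1) 0) ^ (2 - α) ≤ 1 :=
      Real.rpow_le_one (le_max_right _ _) (max_le (by linarith) (by norm_num)) (by linarith)
    have a2 : r ^ (2 - α) ≤ 4 := by
      calc r ^ (2 - α) ≤ 2 ^ (2 - α) := Real.rpow_le_rpow hr0.le hr.le (by linarith)
        _ ≤ (2 : ℝ) ^ (2 : ℝ) := Real.rpow_le_rpow_of_exponent_le (by norm_num) (by linarith)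
        _ = 4 := by norm_num
    have a3 : 0 ≤ (max (r - 1) 0) ^ (2 - α) := Real.rpow_nonneg (le_max_right _ _) _
    have a4 : 0 ≤ r ^ (2 - α) := by positivity
    have a5 : |α / 2 - p| ≤ 1 + p := by rw [abs_le]; constructor <;> linarith
    refine (abs_add_le _ _).trans ?_
    rw [abs_mul, abs_mul, abs_of_nonneg a3, abs_of_nonneg a4,
      abs_of_nonneg (a := 1 + p - α / 2) (by linarith)]
    calc |α / 2 - p| * max (r - 1) 0 ^ (2 - α) + (1 + p - α / 2) * r ^ (2 - α)
        ≤ (1 + p) * 1 + (1 + p) * 4 := by gcongr; linarith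
      _ = _ := by ring
  have h4 : 0 ≤ (p + 2) ^ 2 + 5 * (1 + p) / Real.Gamma (3 - α) := by positivity
  calc _ ≤ (p + 2) ^ 2 + 5 * (1 + p) / Real.Gamma (3 - α) :=
        (abs_sub _ _).trans (add_le_add h2 h3)
    _ ≤ ((p + 2) ^ 2 + 5 * (1 + p) / Real.Gamma (3 - α)) * (2 * r ^ (-α)) :=
        le_mul_of_one_le_right h4 h1
    _ = _ := by ring

lemma exists_abs_kernel_sub_le {α p : ℝ} (hα0 : 0 < α) (hα1 : α < 1) (hp : 0 ≤ p) :
    ∃ C, 0 ≤ C ∧ ∀ r, 0 < r →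
      |grunwaldKernel α p r - twoPointKernel α p r| ≤ C * r ^ (-α) := by
  have hG : 0 < Real.Gamma (3 - α) := Real.Gamma_pos_of_pos (by linarith)
  refine ⟨max (2 * ((p + 2) ^ 2 + 5 * (1 + p) / Real.Gamma (3 - α)))
    (3 * (40 * (p + 2) ^ 2) / Real.Gamma (3 - α)), le_max_of_le_left (by positivity),
    fun r hr => ?_⟩
  rcases lt_or_ge r 2 with h | h
  · exact (abs_kernel_sub_le_of_lt_two hα0 hα1 hp hr h).trans (by gcongr; exact le_max_left _ _)
  · exact (abs_kernel_sub_le_of_two_le hα0 hα1 hp h).trans (by gcongr; exact le_max_right _ _)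

lemma exists_hasDerivAt_of_contDiffOn {n : ℕ} {f : ℝ → ℝ} {b X : ℝ} (hbX : b < X)
    (hf : ContDiffOn ℝ (n + 1) f (Set.Icc b X)) :
    ∃ g : ℝ → ℝ, ContDiffOn ℝ n g (Set.Icc b X) ∧ ∀ t ∈ Set.Ioo b X, HasDerivAt f (g t) t := by
  refine ⟨derivWithin f (Set.Icc b X), hf.derivWithin (uniqueDiffOn_Icc hbX) le_rfl,
    fun t ht => ?_⟩
  have hd : DifferentiableOn ℝ f (Set.Icc b X) := hf.differentiableOn (by simp)
  exact (hd t (Set.Ioo_subset_Icc_self ht)).hasDerivWithinAt.hasDerivAt (Icc_mem_nhds ht.1 ht.2)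

lemma exists_three_derivs {y : ℝ → ℝ} {b X : ℝ} (hbX : b < X)
    (hy : ContDiffOn ℝ 4 y (Set.Icc b X)) :
    ∃ (y₁ y₂ y₃ : ℝ → ℝ) (M : ℝ), ContinuousOn y₁ (Set.Icc b X) ∧
      ContinuousOn y₂ (Set.Icc b X) ∧ Continuous y₃ ∧ (∀ t, |y₃ t| ≤ M) ∧
      (∀ t ∈ Set.Ioo b X, HasDerivAt y (y₁ t) t) ∧ (∀ t ∈ Set.Ioo b X, HasDerivAt y₁ (y₂ t) t) ∧
      (∀ t ∈ Set.Ioo b X, HasDerivAt y₂ (y₃ t) t) := by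
  obtain ⟨y₁, h1, d1⟩ := exists_hasDerivAt_of_contDiffOn (n := 3) hbX
    (by convert hy using 1; norm_num)
  obtain ⟨y₂, h2, d2⟩ := exists_hasDerivAt_of_contDiffOn (n := 2) hbX
    (by convert h1 using 1; norm_num)
  obtain ⟨z, h3, d3⟩ := exists_hasDerivAt_of_contDiffOn (n := 1) hbX
    (by convert h2 using 1; norm_num)
  obtain ⟨M, hM⟩ := isCompact_Icc.exists_bound_of_continuousOn h3.continuousOn
  refine ⟨y₁, y₂, Set.IccExtend hbX.le ((Set.Icc b X).domRestrict z), M, h1.continuousOn,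
    h2.continuousOn, h3.continuousOn.domRestrict.Icc_extend', fun t => ?_, d1, d2, fun t ht => ?_⟩
  · exact hM _ (Subtype.coe_prop _)
  · rw [Set.IccExtend_of_mem _ _ (Set.Ioo_subset_Icc_self ht)]
    exact d3 t ht

lemma taylor_integral_two {y y₁ y₂ y₃ : ℝ → ℝ} {b X T : ℝ} (hbT : b ≤ T) (hTX : T ≤ X)
    (hy : ContinuousOn y (Set.Icc b X)) (h1 : ContinuousOn y₁ (Set.Icc b X))
    (h2 : ContinuousOn y₂ (Set.Icc b X)) (h3 : Continuous y₃)
    (d1 : ∀ t ∈ Set.Ioo b X, HasDerivAt y (y₁ t) t)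
    (d2 : ∀ t ∈ Set.Ioo b X, HasDerivAt y₁ (y₂ t) t)
    (d3 : ∀ t ∈ Set.Ioo b X, HasDerivAt y₂ (y₃ t) t) :
    y T = y b + y₁ b * (T - b) + y₂ b * ((T - b) ^ 2 / 2) +
      ∫ s in b..T, (T - s) ^ 2 / 2 * y₃ s := by
  have hsub : Set.Icc b T ⊆ Set.Icc b X := Set.Icc_subset_Icc_right hTX
  have key := intervalIntegral.integral_eq_sub_of_hasDerivAt_of_le hbT
    (f := fun s => y s + (T - s) * y₁ s + (T - s) ^ 2 / 2 * y₂ s)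
    (f' := fun s => (T - s) ^ 2 / 2 * y₃ s) ?_ ?_ ?_
  · rw [key]; ring
  · refine ((hy.mono hsub).add (ContinuousOn.mul (by fun_prop) (h1.mono hsub))).add
      (ContinuousOn.mul (by fun_prop) (h2.mono hsub))
  · intro s hs
    have hs' : s ∈ Set.Ioo b X := ⟨hs.1, hs.2.trans_le hTX⟩
    have e1 : HasDerivAt (fun s => T - s) (-1) s := by
      simpa using (hasDerivAt_id s).const_sub T
    refine (((d1 s hs').add (e1.mul (d2 s hs'))).add
      (((e1.fun_pow 2).div_const 2).mul (d3 s hs'))).congr_deriv ?_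
    push_cast
    ring
  · exact Continuous.intervalIntegrable (by fun_prop) _ _

lemma continuous_sub_rpow {c a : ℝ} (ha : 0 ≤ a) : Continuous fun s : ℝ => (c - s) ^ a :=
  Continuous.rpow_const (by fun_prop) fun _ => Or.inr ha

lemma intervalIntegrable_sub_rpow {α : ℝ} (hα1 : α < 1) (b c : ℝ) :
    IntervalIntegrable (fun s : ℝ => (c - s) ^ (-α)) MeasureTheory.volume b c := by
  have h := (intervalIntegral.intervalIntegrable_rpow' (a := c - b) (b := 0) (r := -α)
    (by linarith)).comp_sub_left c
  simpa using h

lemma caputo_eq_integral {α : ℝ} {y y₁ y₂ y₃ : ℝ → ℝ} {b X T : ℝ} (hα0 : 0 < α) (hα1 : α < 1)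
    (hbT : b ≤ T) (hTX : T < X) (h1 : ContinuousOn y₁ (Set.Icc b X))
    (h2 : ContinuousOn y₂ (Set.Icc b X)) (h3 : Continuous y₃)
    (d1 : ∀ t ∈ Set.Ioo b X, HasDerivAt y (y₁ t) t)
    (d2 : ∀ t ∈ Set.Ioo b X, HasDerivAt y₁ (y₂ t) t)
    (d3 : ∀ t ∈ Set.Ioo b X, HasDerivAt y₂ (y₃ t) t) :
    caputo α b y T = y₁ b * (T - b) ^ (1 - α) / Real.Gamma (2 - α) +
      y₂ b * (T - b) ^ (2 - α) / Real.Gamma (3 - α) +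
        (∫ s in b..T, (T - s) ^ (2 - α) * y₃ s) / Real.Gamma (3 - α) := by
  have ha : 1 - α ≠ 0 := by linarith
  have ha2 : 2 - α ≠ 0 := by linarith
  have hG : Real.Gamma (1 - α) ≠ 0 := (Real.Gamma_pos_of_pos (by linarith)).ne'
  have g2 : Real.Gamma (2 - α) = (1 - α) * Real.Gamma (1 - α) := by
    rw [← Real.Gamma_add_one ha]
    ring_nf
  have g3 : Real.Gamma (3 - α) = (2 - α) * ((1 - α) * Real.Gamma (1 - α)) := by
    rw [← g2, ← Real.Gamma_add_one ha2]
    ring_nf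
  have hsub : Set.Icc b T ⊆ Set.Icc b X := Set.Icc_subset_Icc_right hTX.le
  have hderiv : ∫ ξ in b..T, deriv y ξ * (T - ξ) ^ (-α) =
      ∫ ξ in b..T, y₁ ξ * (T - ξ) ^ (-α) := by
    refine intervalIntegral.integral_congr_ae (Filter.Eventually.of_forall fun ξ hξ => ?_)
    rw [Set.uIoc_of_le hbT] at hξ
    rw [(d1 ξ ⟨hξ.1, hξ.2.trans_lt hTX⟩).deriv]
  have i1 : IntervalIntegrable (fun ξ => y₁ ξ * (T - ξ) ^ (-α)) MeasureTheory.volume b T :=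
    (intervalIntegrable_sub_rpow hα1 b T).continuousOn_mul
      (by rw [Set.uIcc_of_le hbT]; exact h1.mono hsub)
  have i2 : IntervalIntegrable (fun ξ => (T - ξ) ^ (2 - α) * y₃ ξ / ((1 - α) * (2 - α)))
      MeasureTheory.volume b T :=
    (((continuous_sub_rpow (by linarith)).mul h3).div_const _).intervalIntegrable _ _
  have key := intervalIntegral.integral_eq_sub_of_hasDerivAt_of_le hbT
    (f := fun s => -((T - s) ^ (1 - α) / (1 - α) * y₁ s +
      (T - s) ^ (2 - α) / ((1 - α) * (2 - α)) * y₂ s))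
    (f' := fun s => y₁ s * (T - s) ^ (-α) - (T - s) ^ (2 - α) * y₃ s / ((1 - α) * (2 - α)))
    ?_ ?_ (i1.sub i2)
  · rw [intervalIntegral.integral_sub i1 i2, intervalIntegral.integral_div, sub_self,
      Real.zero_rpow ha, Real.zero_rpow ha2, sub_eq_iff_eq_add] at key
    rw [caputo, hderiv, key, g2, g3]
    field_simp
    ring
  · refine ContinuousOn.neg (ContinuousOn.add (ContinuousOn.mul ?_ (h1.mono hsub))
      (ContinuousOn.mul ?_ (h2.mono hsub)))
    · exact ((continuous_sub_rpow (by linarith)).div_const _).continuousOn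
    · exact ((continuous_sub_rpow (by linarith)).div_const _).continuousOn
  · intro s hs
    have hs' : s ∈ Set.Ioo b X := ⟨hs.1, hs.2.trans hTX⟩
    have hTs : T - s ≠ 0 := by linarith [hs.2]
    have e1 : HasDerivAt (fun s => T - s) (-1) s := by
      simpa using (hasDerivAt_id s).const_sub T
    have e2 := (e1.rpow_const (p := 1 - α) (Or.inl hTs)).div_const (1 - α)
    have e3 := (e1.rpow_const (p := 2 - α) (Or.inl hTs)).div_const ((1 - α) * (2 - α))
    refine ((e2.mul (d2 s hs')).add (e3.mul (d3 s hs'))).neg.congr_deriv ?_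
    rw [show 1 - α - 1 = -α by ring, show 2 - α - 1 = 1 - α by ring]
    field_simp
    ring

lemma sum_integral_eq_integral_grunwaldKernel {α b p h x : ℝ} {n : ℕ} {f : ℝ → ℝ}
    (hf : Continuous f) (hh : 0 < h) (hx : x = b + n * h) :
    IntervalIntegrable (fun s => grunwaldKernel α p ((x - s) / h) * f s)
        MeasureTheory.volume b x ∧
      ∑ k ∈ Finset.range (n + 1), grunwaldW α k *
          ∫ s in b..(x - k * h), (x - k * h + p * h - s) ^ 2 / 2 * f s =
        h ^ 2 * ∫ s in b..x, grunwaldKernel α p ((x - s) / h) * f s := by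
  have hbx : b ≤ x := by rw [hx]; linarith [show 0 ≤ (n : ℝ) * h by positivity]
  set F : ℕ → ℝ → ℝ := fun k => Set.indicator {s | s ≤ x - k * h}
    fun s => (x - k * h + p * h - s) ^ 2 / 2 * f s with hF
  have hFi : ∀ k, IntervalIntegrable (F k) MeasureTheory.volume b x := by
    intro k
    have hc : IntervalIntegrable (fun s => (x - k * h + p * h - s) ^ 2 / 2 * f s)
        MeasureTheory.volume b x := Continuous.intervalIntegrable (by fun_prop) _ _
    rw [intervalIntegrable_iff] at hc ⊢
    exact hc.indicator measurableSet_Iic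
  have hpt : ∀ s ∈ Set.uIoc b x, (∑ k ∈ Finset.range (n + 1), grunwaldW α k * F k s) =
      h ^ 2 * (grunwaldKernel α p ((x - s) / h) * f s) := by
    intro s hs
    rw [Set.uIoc_of_le hbx] at hs
    have hr0 : 0 ≤ (x - s) / h := div_nonneg (by linarith [hs.2]) hh.le
    have hrn : ⌊(x - s) / h⌋₊ ≤ n := by
      refine Nat.floor_le_of_le ?_
      rw [div_le_iff₀ hh]
      linarith [hs.1]
    rw [grunwaldKernel, Finset.sum_mul, Finset.mul_sum]
    symm
    refine Finset.sum_subset_zero_on_sdiff (Finset.range_mono (by omega)) ?_ ?_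
    · intro k hk
      have hk' : (x - s) / h < k := by
        rw [← Nat.floor_lt hr0]
        simp only [Finset.mem_sdiff, Finset.mem_range] at hk
        omega
      rw [div_lt_iff₀ hh] at hk'
      have : s ∉ {s | s ≤ x - k * h} := by
        simp only [Set.mem_ofPred_eq, not_le]; linarith
      simp [hF, Set.indicator_of_notMem this]
    · intro k hk
      have hk' : (k : ℝ) ≤ (x - s) / h := by
        rw [← Nat.le_floor_iff hr0]
        simp only [Finset.mem_range] at hk
        omega
      rw [le_div_iff₀ hh] at hk'
      have : s ∈ {s | s ≤ x - k * h} := by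
        simp only [Set.mem_ofPred_eq]; linarith
      simp only [hF, Set.indicator_of_mem this]
      field_simp
      ring
  have hsum : IntervalIntegrable (fun s => ∑ k ∈ Finset.range (n + 1), grunwaldW α k * F k s)
      MeasureTheory.volume b x := by
    have := IntervalIntegrable.sum (Finset.range (n + 1))
      (f := fun k s => grunwaldW α k * F k s) fun k _ => (hFi k).const_mul _
    refine this.congr fun s _ => ?_
    simp
  have hint : IntervalIntegrable (fun s => h ^ 2 * (grunwaldKernel α p ((x - s) / h) * f s))
      MeasureTheory.volume b x := hsum.congr hpt
  constructor
  · exact (hint.const_mul (h ^ 2)⁻¹).congr fun s _ => by field_simp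
  · rw [← intervalIntegral.integral_const_mul, ← intervalIntegral.integral_congr_ae
      (Filter.Eventually.of_forall hpt), intervalIntegral.integral_finsetSum
        fun k _ => (hFi k).const_mul _]
    refine Finset.sum_congr rfl fun k hk => ?_
    have hk' : (k : ℝ) ≤ n := by
      exact_mod_cast Nat.lt_succ_iff.1 (Finset.mem_range.1 hk)
    rw [intervalIntegral.integral_const_mul]
    congr 1
    symm
    refine intervalIntegral.integral_indicator ⟨?_, ?_⟩
    · rw [hx]; nlinarith
    · linarith [show 0 ≤ (k : ℝ) * h by positivity]

lemma twoPoint_integral_eq {α b p h x : ℝ} {f : ℝ → ℝ} (hα1 : α < 1)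
    (hf : Continuous f) (hh : 0 < h) (hx : b ≤ x - h) :
    IntervalIntegrable (fun s => twoPointKernel α p ((x - s) / h) * f s)
        MeasureTheory.volume b x ∧
      (α / 2 - p) * ((∫ s in b..(x - h), (x - h - s) ^ (2 - α) * f s) / Real.Gamma (3 - α)) +
          (1 + p - α / 2) * ((∫ s in b..x, (x - s) ^ (2 - α) * f s) / Real.Gamma (3 - α)) =
        h ^ (2 - α) * ∫ s in b..x, twoPointKernel α p ((x - s) / h) * f s := by
  have hbx : b ≤ x := by linarith
  have ha2 : 2 - α ≠ 0 := by linarith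
  have c1 : Continuous fun s => (max (x - h - s) 0) ^ (2 - α) * f s :=
    (Continuous.rpow_const (by fun_prop) fun _ => Or.inr (by linarith)).mul hf
  have c2 : Continuous fun s => (x - s) ^ (2 - α) * f s :=
    (continuous_sub_rpow (by linarith)).mul hf
  have e1 : ∫ s in b..(x - h), (x - h - s) ^ (2 - α) * f s =
      ∫ s in b..x, (max (x - h - s) 0) ^ (2 - α) * f s := by
    rw [← intervalIntegral.integral_indicator (a₃ := x) ⟨hx, by linarith⟩]
    refine intervalIntegral.integral_congr fun s _ => ?_
    by_cases hs : s ≤ x - h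
    · simp only [Set.indicator, Set.mem_ofPred_eq, hs, if_true]
      rw [max_eq_left (by linarith)]
    · simp only [Set.indicator, Set.mem_ofPred_eq, hs, if_false]
      rw [max_eq_right (by linarith), Real.zero_rpow ha2, zero_mul]
  have e2 : ∀ s ∈ Set.uIcc b x, h ^ (2 - α) * (twoPointKernel α p ((x - s) / h) * f s) =
      (α / 2 - p) / Real.Gamma (3 - α) * ((max (x - h - s) 0) ^ (2 - α) * f s) +
        (1 + p - α / 2) / Real.Gamma (3 - α) * ((x - s) ^ (2 - α) * f s) := by
    intro s hs
    rw [Set.uIcc_of_le hbx] at hs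
    have hr : 0 ≤ (x - s) / h := div_nonneg (by linarith [hs.2]) hh.le
    have m1 : (x - s) ^ (2 - α) = h ^ (2 - α) * ((x - s) / h) ^ (2 - α) := by
      rw [← Real.mul_rpow hh.le hr]
      congr 1
      field_simp
    have m2 : (max (x - h - s) 0) ^ (2 - α) =
        h ^ (2 - α) * (max ((x - s) / h - 1) 0) ^ (2 - α) := by
      rw [← Real.mul_rpow hh.le (le_max_right _ _), mul_max_of_nonneg _ _ hh.le]
      congr 2
      · field_simp
        ring
      · simp
    rw [m1, m2, twoPointKernel]
    ring
  have hint : IntervalIntegrable (fun s => h ^ (2 - α) * (twoPointKernel α p ((x - s) / h) * f s))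
      MeasureTheory.volume b x :=
    (((c1.intervalIntegrable b x).const_mul _).add ((c2.intervalIntegrable b x).const_mul _)).congr
      fun s hs => (e2 s (Set.uIoc_subset_uIcc hs)).symm
  have hhp : h ^ (2 - α) ≠ 0 := by positivity
  constructor
  · exact (hint.const_mul (h ^ (2 - α))⁻¹).congr fun s _ => by field_simp
  · rw [← intervalIntegral.integral_const_mul, intervalIntegral.integral_congr e2,
      intervalIntegral.integral_add ((c1.intervalIntegrable b x).const_mul _)
        ((c2.intervalIntegrable b x).const_mul _), intervalIntegral.integral_const_mul,
      intervalIntegral.integral_const_mul, e1]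
    ring

lemma abs_integral_kernel_sub_le {α b p h x C M : ℝ} {f : ℝ → ℝ} (hα1 : α < 1)
    (hh : 0 < h) (hbx : b ≤ x) (hC : 0 ≤ C)
    (hK : ∀ r, 0 < r → |grunwaldKernel α p r - twoPointKernel α p r| ≤ C * r ^ (-α))
    (hM : ∀ t, |f t| ≤ M) :
    |∫ s in b..x, (grunwaldKernel α p ((x - s) / h) - twoPointKernel α p ((x - s) / h)) * f s| ≤
      C * M * h ^ α * ∫ s in b..x, (x - s) ^ (-α) := by
  rw [← intervalIntegral.integral_const_mul, ← Real.norm_eq_abs]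
  refine intervalIntegral.norm_integral_le_of_norm_le hbx ?_
    ((intervalIntegrable_sub_rpow hα1 b x).const_mul _)
  filter_upwards [MeasureTheory.Measure.ae_ne MeasureTheory.volume x] with s hsx hs
  have hs' : 0 < x - s := sub_pos.2 (lt_of_le_of_ne hs.2 hsx)
  have h1 := hK ((x - s) / h) (by positivity)
  have e : ((x - s) / h) ^ (-α) = h ^ α * (x - s) ^ (-α) := by
    rw [Real.div_rpow hs'.le hh.le, Real.rpow_neg hh.le α, div_inv_eq_mul, mul_comm]
  rw [Real.norm_eq_abs, abs_mul]
  calc _ ≤ C * ((x - s) / h) ^ (-α) * M := by gcongr; exact hM s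
    _ = _ := by rw [e]; ring

lemma abs_integral_sq_mul_le {f : ℝ → ℝ} {t T M : ℝ} (htT : t ≤ T) (hM : ∀ s, |f s| ≤ M) :
    |∫ s in t..T, (T - s) ^ 2 / 2 * f s| ≤ M * (T - t) ^ 3 := by
  have hM0 : 0 ≤ M := (abs_nonneg _).trans (hM t)
  have h := intervalIntegral.norm_integral_le_of_norm_le_const (a := t) (b := T)
    (f := fun s => (T - s) ^ 2 / 2 * f s) (C := (T - t) ^ 2 * M) fun s hs => ?_
  · rw [Real.norm_eq_abs, abs_of_nonneg (sub_nonneg.2 htT)] at h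
    exact h.trans_eq (by ring)
  · rw [Set.uIoc_of_le htT] at hs
    rw [Real.norm_eq_abs, abs_mul, abs_of_nonneg (by positivity)]
    have h1 : (T - s) ^ 2 / 2 ≤ (T - t) ^ 2 := by nlinarith [hs.1, hs.2, sq_nonneg (T - s)]
    exact mul_le_mul h1 (hM s) (abs_nonneg _) (sq_nonneg _)

lemma abs_shiftedGrunwald_sub_le {α b p h x X M : ℝ} {n : ℕ} {y y₁ y₂ y₃ : ℝ → ℝ}
    (hα0 : 0 < α) (hα1 : α < 1) (hp : 0 ≤ p) (hh : 0 < h) (hx : x = b + n * h)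
    (hX : x + p * h ≤ X) (hyb : y b = 0)
    (hy : ContinuousOn y (Set.Icc b X)) (h1 : ContinuousOn y₁ (Set.Icc b X))
    (h2 : ContinuousOn y₂ (Set.Icc b X)) (h3 : Continuous y₃) (hM : ∀ t, |y₃ t| ≤ M)
    (d1 : ∀ t ∈ Set.Ioo b X, HasDerivAt y (y₁ t) t)
    (d2 : ∀ t ∈ Set.Ioo b X, HasDerivAt y₁ (y₂ t) t)
    (d3 : ∀ t ∈ Set.Ioo b X, HasDerivAt y₂ (y₃ t) t) :
    |shiftedGrunwald α b p h y x -
        (y₁ b * h * ∑ k ∈ Finset.range (n + 1), grunwaldW α k * ((n : ℝ) - k + p) +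
          y₂ b * h ^ 2 * grunwaldKernel α p n +
          h ^ 2 * ∫ s in b..x, grunwaldKernel α p ((x - s) / h) * y₃ s)| ≤
      2 * (M * (p * h) ^ 3) := by
  have hM0 : 0 ≤ M := (abs_nonneg _).trans (hM 0)
  have hfl : ⌊(x - b) / h⌋₊ = n := by
    rw [hx, show (b + n * h - b) / h = n by field_simp; ring, Nat.floor_natCast]
  have hterm : ∀ k ∈ Finset.range (n + 1), y (x - ((k : ℝ) - p) * h) =
      y₁ b * h * ((n : ℝ) - k + p) + y₂ b * h ^ 2 * (((n : ℝ) - k + p) ^ 2 / 2) +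
        (∫ s in b..(x - k * h), (x - k * h + p * h - s) ^ 2 / 2 * y₃ s) +
        ∫ s in (x - k * h)..(x - k * h + p * h), (x - k * h + p * h - s) ^ 2 / 2 * y₃ s := by
    intro k hk
    have hk' : (k : ℝ) ≤ n := by exact_mod_cast Nat.lt_succ_iff.1 (Finset.mem_range.1 hk)
    have hkh : (k : ℝ) * h ≤ n * h := by gcongr
    have hk0 : 0 ≤ (k : ℝ) * h := by positivity
    have hph : 0 ≤ p * h := by positivity
    have hc : Continuous fun s => (x - k * h + p * h - s) ^ 2 / 2 * y₃ s := by fun_prop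
    rw [show x - ((k : ℝ) - p) * h = x - k * h + p * h by ring,
      taylor_integral_two (T := x - k * h + p * h) (by linarith) (by linarith) hy h1 h2 h3 d1 d2 d3,
      hyb, ← intervalIntegral.integral_add_adjacent_intervals (b := x - k * h)
        (hc.intervalIntegrable _ _) (hc.intervalIntegrable _ _), hx]
    ring
  rw [shiftedGrunwald, hfl, ← (sum_integral_eq_integral_grunwaldKernel (p := p) h3 hh hx).2,
    grunwaldKernel, Nat.floor_natCast, Finset.mul_sum, Finset.mul_sum, ← Finset.sum_add_distrib,
    ← Finset.sum_add_distrib, ← Finset.sum_sub_distrib]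
  calc _ ≤ ∑ k ∈ Finset.range (n + 1), |grunwaldW α k| * (M * (p * h) ^ 3) := by
        refine (Finset.abs_sum_le_sum_abs _ _).trans (Finset.sum_le_sum fun k hk => ?_)
        have hb := abs_integral_sq_mul_le (t := x - k * h) (T := x - k * h + p * h)
          (by linarith [mul_nonneg hp hh.le]) hM
        rw [add_sub_cancel_left] at hb
        refine le_trans (le_of_eq ?_) (mul_le_mul_of_nonneg_left hb (abs_nonneg (grunwaldW α k)))
        rw [hterm k hk, ← abs_mul]
        congr 1
        ring
    _ ≤ _ := by
        rw [← Finset.sum_mul]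
        exact mul_le_mul_of_nonneg_right (sum_abs_grunwaldW_le hα0 hα1 n) (by positivity)

/-- The weighted average of two Caputo derivatives, split into the contributions of the
linear term, the quadratic term and the integral remainder of the Taylor expansion at `b`. -/
lemma two_point_caputo_eq {α b p h x X : ℝ} {n : ℕ} {y y₁ y₂ y₃ : ℝ → ℝ}
    (hα0 : 0 < α) (hα1 : α < 1) (hh : 0 < h) (hn : 1 ≤ n) (hx : x = b + n * h)
    (hX : x < X) (h1 : ContinuousOn y₁ (Set.Icc b X))
    (h2 : ContinuousOn y₂ (Set.Icc b X)) (h3 : Continuous y₃)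
    (d1 : ∀ t ∈ Set.Ioo b X, HasDerivAt y (y₁ t) t)
    (d2 : ∀ t ∈ Set.Ioo b X, HasDerivAt y₁ (y₂ t) t)
    (d3 : ∀ t ∈ Set.Ioo b X, HasDerivAt y₂ (y₃ t) t) :
    (α / 2 - p) * caputo α b y (x - h) + (1 + p - α / 2) * caputo α b y x =
      y₁ b * h ^ (1 - α) * (((α / 2 - p) * ((n : ℝ) - 1) ^ (1 - α) +
        (1 + p - α / 2) * (n : ℝ) ^ (1 - α)) / Real.Gamma (2 - α)) +
      y₂ b * h ^ (2 - α) * twoPointKernel α p n +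
      h ^ (2 - α) * ∫ s in b..x, twoPointKernel α p ((x - s) / h) * y₃ s := by
  have hn' : (1 : ℝ) ≤ n := by exact_mod_cast hn
  have hnh : h ≤ n * h := by nlinarith
  rw [← (twoPoint_integral_eq hα1 h3 hh (by linarith)).2,
    caputo_eq_integral hα0 hα1 (T := x - h) (by linarith) (by linarith) h1 h2 h3 d1 d2 d3,
    caputo_eq_integral hα0 hα1 (T := x) (by linarith) hX h1 h2 h3 d1 d2 d3, twoPointKernel,
    max_eq_left (by linarith), show x - h - b = h * ((n : ℝ) - 1) by rw [hx]; ring,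
    show x - b = h * n by rw [hx]; ring]
  rw [Real.mul_rpow hh.le (by linarith), Real.mul_rpow hh.le (by linarith),
    Real.mul_rpow hh.le (by linarith), Real.mul_rpow hh.le (by linarith)]
  ring

lemma rpow_mul_rpow_eq {h a c d : ℝ} {L : ℝ} {n : ℕ} (hh : 0 < h) (hL : L = n * h)
    (hacd : a = c + d) : h ^ a * (n : ℝ) ^ c = h ^ d * L ^ c := by
  rw [hL, hacd, Real.mul_rpow (Nat.cast_nonneg n) hh.le, Real.rpow_add hh]
  ring

/-- second order approximation of the shifted Grünwald formula by a
weighted average of two consecutive Caputo derivatives on a uniform grid. -/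
theorem shiftedGrunwald_weighted_two_point
    (α p b X x : ℝ) (y : ℝ → ℝ)
    (hα0 : 0 < α) (hα1 : α < 1) (hp : 0 ≤ p)
    (hy : ContDiffOn ℝ 4 y (Set.Icc b X))
    (hext : ∀ t, t < b → y t = 0)
    (hyb : y b = 0) (hyb1 : deriv y b = 0) (hyb2 : deriv (deriv y) b = 0)
    (hbx : b < x) (hxX : x < X) :
    ∃ C > 0, ∃ h₀ > 0, ∀ n : ℕ, 1 ≤ n → ∀ h : ℝ, h = (x - b) / n →
      0 < h → h < h₀ → x + p * h ≤ X →
      |h ^ (-α) * shiftedGrunwald α b p h y x -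
          ((α / 2 - p) * caputo α b y (x - h) +
            (1 + p - α / 2) * caputo α b y x)| ≤ C * h ^ 2 := by
  obtain ⟨y₁, y₂, y₃, M, h1, h2, h3, hM, d1, d2, d3⟩ := exists_three_derivs (hbx.trans hxX) hy
  obtain ⟨K, hK0, hK⟩ := exists_abs_kernel_sub_le hα0 hα1 hp
  have hM0 : 0 ≤ M := (abs_nonneg _).trans (hM 0)
  have hL : 0 < x - b := sub_pos.2 hbx
  set L := x - b with hLdef
  set I := ∫ s in b..x, (x - s) ^ (-α) with hI
  have hI0 : 0 ≤ I := intervalIntegral.integral_nonneg hbx.le fun s hs =>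
    Real.rpow_nonneg (sub_nonneg.2 hs.2) _
  have hG2 : 0 < Real.Gamma (2 - α) := Real.Gamma_pos_of_pos (by linarith)
  set K₁ := 4 * (8 * p + 6) / Real.Gamma (2 - α) with hK₁
  have hK₁0 : 0 ≤ K₁ := by positivity
  refine ⟨|y₁ b| * K₁ * L ^ (-1 - α) + |y₂ b| * K * L ^ (-α) + K * M * I + 2 * M * p ^ 3 + 1,
    by positivity, min 1 L, by positivity, fun n hn h hh hh0 hhlt hX => ?_⟩
  have hh1 : h < 1 := hhlt.trans_le (min_le_left _ _)
  have hhL : h < L := hhlt.trans_le (min_le_right _ _)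
  have hn0 : (0 : ℝ) < n := by exact_mod_cast hn
  have hLn : L = n * h := by rw [hh]; field_simp
  have hx : x = b + n * h := by rw [← hLn, hLdef]; ring
  have hn2 : 2 ≤ n := by
    by_contra hlt
    have : n = 1 := by omega
    rw [hLn, this] at hhL
    simp at hhL
  have hbd := abs_shiftedGrunwald_sub_le hα0 hα1 hp hh0 hx hX hyb hy.continuousOn h1 h2 h3 hM
    d1 d2 d3
  have hmom := abs_linear_moment_sub_le hα0 hα1 hp hn2
  have hker := hK n hn0
  have hint := abs_integral_kernel_sub_le (b := b) (x := x) hα1 hh0 hbx.le hK0 hK hM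
  have iG := (sum_integral_eq_integral_grunwaldKernel (α := α) (p := p) h3 hh0 hx).1
  have iT := (twoPoint_integral_eq (p := p) (b := b) (x := x) hα1 h3 hh0 (by linarith)).1
  simp only [sub_mul] at hint
  rw [intervalIntegral.integral_sub iG iT] at hint
  rw [two_point_caputo_eq hα0 hα1 hh0 hn hx hxX h1 h2 h3 d1 d2 d3]
  set S := ∑ k ∈ Finset.range (n + 1), grunwaldW α k * ((n : ℝ) - k + p)
  set S' := ((α / 2 - p) * ((n : ℝ) - 1) ^ (1 - α) +
    (1 + p - α / 2) * (n : ℝ) ^ (1 - α)) / Real.Gamma (2 - α)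
  set A := ∫ s in b..x, grunwaldKernel α p ((x - s) / h) * y₃ s
  set B := ∫ s in b..x, twoPointKernel α p ((x - s) / h) * y₃ s
  set G := shiftedGrunwald α b p h y x
  set E := G - (y₁ b * h * S + y₂ b * h ^ 2 * grunwaldKernel α p n + h ^ 2 * A) with hE
  have e1 : h ^ (1 - α) = h ^ (-α) * h := by
    rw [← Real.rpow_add_one hh0.ne']; ring_nf
  have e2 : h ^ (2 - α) = h ^ (-α) * h ^ 2 := by
    rw [← Real.rpow_natCast h 2, ← Real.rpow_add hh0]; push_cast; ring_nf
  have b1 : |y₁ b * h ^ (1 - α) * (S - S')| ≤ |y₁ b| * K₁ * L ^ (-1 - α) * h ^ 2 := by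
    rw [abs_mul, abs_mul, abs_of_pos (Real.rpow_pos_of_pos hh0 _)]
    calc _ ≤ |y₁ b| * h ^ (1 - α) * (K₁ * (n : ℝ) ^ (-1 - α)) := by gcongr
      _ = |y₁ b| * K₁ * (h ^ (1 - α) * (n : ℝ) ^ (-1 - α)) := by ring
      _ = _ := by
        rw [rpow_mul_rpow_eq (d := 2) hh0 hLn (by ring), Real.rpow_two]; ring
  have b2 : |y₂ b * h ^ (2 - α) * (grunwaldKernel α p n - twoPointKernel α p n)| ≤
      |y₂ b| * K * L ^ (-α) * h ^ 2 := by
    rw [abs_mul, abs_mul, abs_of_pos (Real.rpow_pos_of_pos hh0 _)]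
    calc _ ≤ |y₂ b| * h ^ (2 - α) * (K * (n : ℝ) ^ (-α)) := by gcongr
      _ = |y₂ b| * K * (h ^ (2 - α) * (n : ℝ) ^ (-α)) := by ring
      _ = _ := by
        rw [rpow_mul_rpow_eq (d := 2) hh0 hLn (by ring), Real.rpow_two]; ring
  have hαα : h ^ (-α) * h ^ α = 1 := by
    rw [← Real.rpow_add hh0, neg_add_cancel, Real.rpow_zero]
  have b3 : |h ^ (2 - α) * (A - B)| ≤ K * M * I * h ^ 2 := by
    rw [abs_mul, abs_of_pos (Real.rpow_pos_of_pos hh0 _)]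
    calc _ ≤ h ^ (2 - α) * (K * M * h ^ α * I) := by gcongr
      _ = K * M * I * h ^ 2 * (h ^ (-α) * h ^ α) := by rw [e2]; ring
      _ = _ := by rw [hαα, mul_one]
  have hle : h ^ (-α) * h ≤ 1 := by
    rw [← e1]
    exact Real.rpow_le_one hh0.le hh1.le (by linarith)
  have b4 : |h ^ (-α) * E| ≤ 2 * M * p ^ 3 * h ^ 2 := by
    rw [abs_mul, abs_of_pos (Real.rpow_pos_of_pos hh0 _)]
    calc _ ≤ h ^ (-α) * (2 * (M * (p * h) ^ 3)) := by gcongr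
      _ = 2 * M * p ^ 3 * h ^ 2 * (h ^ (-α) * h) := by ring
      _ ≤ 2 * M * p ^ 3 * h ^ 2 * 1 := by gcongr
      _ = _ := mul_one _
  have hsplit : h ^ (-α) * G - (y₁ b * h ^ (1 - α) * S' +
      y₂ b * h ^ (2 - α) * twoPointKernel α p n + h ^ (2 - α) * B) =
      y₁ b * h ^ (1 - α) * (S - S') +
      y₂ b * h ^ (2 - α) * (grunwaldKernel α p n - twoPointKernel α p n) +
      h ^ (2 - α) * (A - B) + h ^ (-α) * E := by
    rw [hE, e1, e2]
    ring
  rw [hsplit]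
  refine (abs_add_le _ _).trans ((add_le_add_left ((abs_add_le _ _).trans
    (add_le_add_left (abs_add_le _ _) _)) _).trans ?_)
  nlinarith [sq_nonneg h]
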